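/- arXiv:1908.10487 — 4 statements merged into one kernel-verified Lean document; each statement's English description precedes it below -/
import Mathlib

section
/- Let a₁, a₂, b ∈ ℂ^N with a₁ + a₂ ∈ S(b). Define a₃ ∈ ℂ^N componentwise by: Re((a₃)ₙ) = 0 if Re((a₂)ₙ)·Re((a₁)ₙ) ≥ 0 or |Re((a₁)ₙ)| > |Re((a₂)ₙ)|, and Re((a₃)ₙ) = Re((a₂)ₙ) otherwise; and Im((a₃)ₙ) = 0 if Im((a₂)ₙ)·Im((a₁)ₙ) ≥ 0 or |Im((a₁)ₙ)| > |Im((a₂)ₙ)|, and Im((a₃)ₙ) = Im((a₂)ₙ) otherwise. Then a₁ + a₃ ∈ S(b). -/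
/-- `a ∈ S(b)`: componentwise, the real parts and imaginary parts have matching signs. -/
def inS {N : ℕ} (a b : Fin N → ℂ) : Prop :=
  ∀ n, 0 ≤ (a n).re * (b n).re ∧ 0 ≤ (a n).im * (b n).im

/-- A real number `x` has the sign of `x + y` whenever `y` does not oppose `x` or is smaller. -/
theorem mul_nonneg_of_add_mul_nonneg {x y b : ℝ} (h : 0 ≤ (x + y) * b)
    (hxy : 0 ≤ y * x ∨ |y| < |x|) : 0 ≤ x * b := by
  rcases eq_or_ne x 0 with rfl | hx
  · simp
  have hpos : 0 < x * (x + y) := by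
    rcases hxy with hxy | hxy
    · have := sq_pos_of_ne_zero hx
      nlinarith
    · have := sq_lt_sq.mpr hxy
      nlinarith [sq_nonneg (x + y)]
  have hne : x + y ≠ 0 := right_ne_zero_of_mul hpos.ne'
  have hmul : 0 ≤ (x + y) ^ 2 * (x * b) := by
    linear_combination mul_nonneg hpos.le h
  exact nonneg_of_mul_nonneg_right hmul (by positivity)

theorem add_ite_mul_nonneg {x y b : ℝ} (h : 0 ≤ (x + y) * b) :
    0 ≤ (x + if 0 ≤ y * x ∨ |y| < |x| then 0 else y) * b := by
  split_ifs with hxy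
  · simpa using mul_nonneg_of_add_mul_nonneg h hxy
  · exact h

theorem stmt_3 {N : ℕ} (a₁ a₂ b : Fin N → ℂ) (h : inS (a₁ + a₂) b)
    (a₃ : Fin N → ℂ)
    (ha₃ : ∀ n, a₃ n =
      ⟨if 0 ≤ (a₂ n).re * (a₁ n).re ∨ |(a₂ n).re| < |(a₁ n).re| then 0 else (a₂ n).re,
       if 0 ≤ (a₂ n).im * (a₁ n).im ∨ |(a₂ n).im| < |(a₁ n).im| then 0 else (a₂ n).im⟩) :
    inS (a₁ + a₃) b := by
  intro n
  simp only [Pi.add_apply, ha₃, Complex.add_re, Complex.add_im]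
  exact ⟨add_ite_mul_nonneg (h n).1, add_ite_mul_nonneg (h n).2⟩
end

section
/- Every Hermitian positive semidefinite Toeplitz matrix T ∈ ℂ^{L×L} of rank R admits a Vandermonde decomposition: there exist p₁,…,p_R > 0 and pairwise distinct frequencies f₁,…,f_R ∈ [0,1) such that T = Σ_{k=1}^R p_k w_L(f_k) w_L(f_k)ᴴ. -/
open Matrix ComplexOrder

/-- The complex sinusoid vector `w_L(f)` with entries `e^{2πi f n}`, `n = 0,…,L−1`. -/
noncomputable def wvec (L : ℕ) (f : ℝ) : Fin L → ℂ :=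
  fun n => Complex.exp (2 * Real.pi * Complex.I * (f : ℂ) * (n : ℂ))

/-- The rank-one atom `w_M(f) w_Q(g)ᴴ`. -/
noncomputable def atom (M Q : ℕ) (f g : ℝ) : Matrix (Fin M) (Fin Q) ℂ :=
  Matrix.vecMulVec (wvec M f) (fun j => starRingEnd ℂ (wvec Q g j))

/-- `X` admits an atomic decomposition with `K` atoms. -/
def HasAtomicDecomp {M Q : ℕ} (X : Matrix (Fin M) (Fin Q) ℂ) (K : ℕ) : Prop :=
  ∃ (a φ f g : Fin K → ℝ),
    (∀ k, 0 < a k) ∧ (∀ k, φ k ∈ Set.Ico 0 (2 * Real.pi)) ∧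
    (∀ k, f k ∈ Set.Ico (0 : ℝ) 1) ∧ (∀ k, g k ∈ Set.Ico (0 : ℝ) 1) ∧
    X = ∑ k, ((a k : ℂ) * Complex.exp (Complex.I * (φ k : ℂ))) • atom M Q (f k) (g k)

/-- The atomic ℓ0 norm `‖X‖_{A,0}`. -/
noncomputable def atomicL0Norm {M Q : ℕ} (X : Matrix (Fin M) (Fin Q) ℂ) : ℕ :=
  sInf {K | HasAtomicDecomp X K}

/-- The Hermitian Toeplitz matrix `T(u)` with `uᵀ` as its first row. -/
noncomputable def Toep (L : ℕ) (u : Fin L → ℂ) : Matrix (Fin L) (Fin L) ℂ :=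
  Matrix.of fun i j =>
    if (i : ℕ) ≤ (j : ℕ) then u ⟨(j : ℕ) - (i : ℕ), Nat.lt_of_le_of_lt (Nat.sub_le _ _) j.isLt⟩
    else starRingEnd ℂ (u ⟨(i : ℕ) - (j : ℕ), Nat.lt_of_le_of_lt (Nat.sub_le _ _) i.isLt⟩)

section Isometry

open Module Module.End Submodule

variable {V : Type*} [NormedAddCommGroup V] [InnerProductSpace ℂ V]

/-- A correspondence between two finite families with the same Gram matrix extends to a linear
isometry of the ambient space. -/
theorem exists_linearIsometry_of_gram_eq [FiniteDimensional ℂ V] {ι : Type*} [Fintype ι]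
    {x y : ι → V} (h : gram ℂ x = gram ℂ y) : ∃ U : V →ₗᵢ[ℂ] V, ∀ i, U (x i) = y i := by
  classical
  let A := Fintype.linearCombination ℂ x
  let B := Fintype.linearCombination ℂ y
  have hAB (c : ι → ℂ) : ‖B c‖ = ‖A c‖ := by
    have : inner ℂ (B c) (B c) = inner ℂ (A c) (A c) := by
      simp only [A, B, Fintype.linearCombination_apply, ← star_dotProduct_gram_mulVec, h]
    rw [@norm_eq_sqrt_re_inner ℂ, @norm_eq_sqrt_re_inner ℂ _ _ _ _ (A c), this]
  obtain ⟨g, hg⟩ := A.rangeRestrict.exists_rightInverse_of_surjective A.range_rangeRestrict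
  have hg' (v : A.range) : A (g v) = v := congrArg Subtype.val (LinearMap.congr_fun hg v)
  let f : A.range →ₗᵢ[ℂ] V := ⟨B ∘ₗ g, fun v => by simp [hAB, hg']⟩
  have hf (c : ι → ℂ) : f (A.rangeRestrict c) = B c := by
    have : ‖B (g (A.rangeRestrict c) - c)‖ = 0 := by
      rw [hAB, map_sub, hg']
      simp
    rw [norm_eq_zero, map_sub, sub_eq_zero] at this
    exact this
  refine ⟨f.extend, fun i => ?_⟩
  have hx : x i = (A.rangeRestrict (Pi.single i 1) : V) := by
    simp [A, Fintype.linearCombination_apply_single]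
  rw [hx, LinearIsometry.extend_apply, hf]
  simp [B, Fintype.linearCombination_apply_single]

namespace LinearIsometry

theorem norm_eq_one_of_apply_eq_smul (U : V →ₗᵢ[ℂ] V) {μ : ℂ} {v : V} (h : U v = μ • v)
    (hv : v ≠ 0) : ‖μ‖ = 1 := by
  have := U.norm_map v
  rw [h, norm_smul] at this
  exact mul_eq_right₀ (norm_ne_zero_iff.mpr hv) |>.mp this

theorem inner_apply_of_apply_eq_smul (U : V →ₗᵢ[ℂ] V) {μ : ℂ} {v : V} (h : U v = μ • v) (w : V) :
    inner ℂ v (U w) = μ * inner ℂ v w := by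
  by_cases hv : v = 0
  · simp [hv]
  have hμ : μ * starRingEnd ℂ μ = 1 := by
    rw [Complex.mul_conj', U.norm_eq_one_of_apply_eq_smul h hv]
    simp
  rw [← U.inner_map_map v w, h, inner_smul_left, ← mul_assoc, hμ, one_mul]

theorem orthogonalFamily_eigenspaces (U : V →ₗᵢ[ℂ] V) :
    OrthogonalFamily ℂ (fun μ => eigenspace U.toLinearMap μ)
      fun μ => (eigenspace U.toLinearMap μ).subtypeₗᵢ := by
  rintro μ ν hμν ⟨v, hv⟩ ⟨w, hw⟩
  rw [mem_eigenspace_iff] at hv hw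
  have h := U.inner_apply_of_apply_eq_smul hv w
  rw [← U.coe_toLinearMap, hw, inner_smul_right] at h
  by_contra h0
  exact hμν (mul_right_cancel₀ h0 h).symm

theorem orthogonal_iSup_eigenspaces_eq_bot [FiniteDimensional ℂ V] (U : V →ₗᵢ[ℂ] V) :
    (⨆ μ, eigenspace U.toLinearMap μ)ᗮ = ⊥ := by
  set W := (⨆ μ, eigenspace U.toLinearMap μ)ᗮ with hW
  have hinv : ∀ w ∈ W, U.toLinearMap w ∈ W := by
    intro w hw
    rw [hW, ← iInf_orthogonal, mem_iInf] at hw ⊢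
    intro μ v hv
    rw [coe_toLinearMap, U.inner_apply_of_apply_eq_smul (mem_eigenspace_iff.mp hv), hw μ v hv,
      mul_zero]
  by_contra hne
  have := nontrivial_iff_ne_bot.mpr hne
  obtain ⟨μ, hμ⟩ := exists_eigenvalue (U.toLinearMap.restrict hinv)
  refine hμ (eigenspace_restrict_eq_bot hinv ?_)
  exact ((isOrtho_orthogonal_right _).mono_left
    (le_iSup (fun μ => eigenspace U.toLinearMap μ) μ)).disjoint

/-- A linear isometry of a finite-dimensional complex inner product space has an orthonormal
basis of eigenvectors. -/
theorem exists_orthonormalBasis_apply_eq_smul [FiniteDimensional ℂ V] (U : V →ₗᵢ[ℂ] V) {n : ℕ}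
    (hn : finrank ℂ V = n) :
    ∃ (b : OrthonormalBasis (Fin n) ℂ V) (z : Fin n → ℂ), ∀ k, U (b k) = z k • b k := by
  classical
  have hO : OrthogonalFamily ℂ (fun μ : Eigenvalues U.toLinearMap => eigenspace U.toLinearMap μ)
      fun μ => (eigenspace U.toLinearMap μ).subtypeₗᵢ :=
    U.orthogonalFamily_eigenspaces.comp Subtype.coe_injective
  have hI : DirectSum.IsInternal
      fun μ : Eigenvalues U.toLinearMap => eigenspace U.toLinearMap μ := by
    refine hO.isInternal_iff.mpr ?_
    change (⨆ μ : {μ // eigenspace U.toLinearMap μ ≠ ⊥}, eigenspace U.toLinearMap μ)ᗮ = ⊥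
    rw [iSup_ne_bot_subtype, U.orthogonal_iSup_eigenspaces_eq_bot]
  exact ⟨hI.subordinateOrthonormalBasis hn hO,
    fun k => (hI.subordinateOrthonormalBasisIndex hn k hO).val,
    fun k => mem_eigenspace_iff.mp (hI.subordinateOrthonormalBasis_subordinate hn k hO)⟩

end LinearIsometry

end Isometry

/-- A positive semidefinite matrix is the Gram matrix of a family spanning a space whose dimension
is the rank of the matrix. -/
theorem Matrix.PosSemidef.exists_gram_eq {n : Type*} [Fintype n] {T : Matrix n n ℂ}
    (hT : T.PosSemidef) :
    ∃ (V : Submodule ℂ (EuclideanSpace ℂ n)) (x : n → V),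
      T = gram ℂ x ∧ Submodule.span ℂ (Set.range x) = ⊤ ∧ Module.finrank ℂ V = T.rank := by
  classical
  obtain ⟨B, rfl⟩ : ∃ B : Matrix n n ℂ, T = Bᴴ * B := by
    open scoped MatrixOrder in
    exact CStarAlgebra.nonneg_iff_eq_star_mul_self.mp hT.nonneg
  let e : (n → ℂ) ≃ₗ[ℂ] EuclideanSpace ℂ n := (WithLp.linearEquiv 2 ℂ (n → ℂ)).symm
  refine ⟨Submodule.span ℂ (Set.range fun i => e (B.col i)),
    fun i => ⟨e (B.col i), Submodule.subset_span ⟨i, rfl⟩⟩, ?_, ?_, ?_⟩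
  · ext i j
    simp [e, mul_apply, PiLp.inner_apply, mul_comm]
  · exact Submodule.span_range_subtype_eq_top_iff _ _ |>.mpr rfl
  · rw [rank_conjTranspose_mul_self, rank_eq_finrank_span_cols, ← e.finrank_map_eq,
      Submodule.map_span, ← Set.range_comp]
    rfl

theorem Complex.exists_exp_two_pi_mul_I_eq {z : ℂ} (hz : ‖z‖ = 1) :
    ∃ f ∈ Set.Ico (0 : ℝ) 1, Complex.exp (2 * Real.pi * Complex.I * f) = z := by
  refine ⟨Int.fract (z.arg / (2 * Real.pi)), ⟨Int.fract_nonneg _, Int.fract_lt_one _⟩, ?_⟩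
  have hπ : (Real.pi : ℂ) ≠ 0 := mod_cast Real.pi_ne_zero
  have h : (2 * Real.pi * Complex.I * (Int.fract (z.arg / (2 * Real.pi)) : ℝ) : ℂ) =
      z.arg * Complex.I - ⌊z.arg / (2 * Real.pi)⌋ * (2 * Real.pi * Complex.I) := by
    rw [← Int.self_sub_floor]
    push_cast
    field_simp
  rw [h, Complex.exp_sub, Complex.exp_int_mul_two_pi_mul_I, div_one]
  simpa [hz] using Complex.norm_mul_exp_arg_mul_I z

theorem wvec_apply (L : ℕ) (f : ℝ) (n : Fin L) :
    wvec L f n = Complex.exp (2 * Real.pi * Complex.I * f) ^ (n : ℕ) := by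
  rw [wvec, ← Complex.exp_nat_mul, mul_comm (n : ℂ)]

/-- If the orbit of `v` under powers of `U` spans the space and `b` is an orthonormal eigenbasis
of `U`, then no coordinate of `v` vanishes and the eigenvalues are pairwise distinct. -/
theorem eigenbasis_of_cyclic {V : Type*} [NormedAddCommGroup V] [InnerProductSpace ℂ V]
    {ι κ : Type*} [Fintype ι] (b : OrthonormalBasis ι ℂ V) {z c : ι → ℂ} {x : κ → V} {m : κ → ℕ}
    (hx : ∀ i k, inner ℂ (b k) (x i) = z k ^ m i * c k)
    (hspan : Submodule.span ℂ (Set.range x) = ⊤) :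
    (∀ k, c k ≠ 0) ∧ Function.Injective z := by
  have hzero (v : V) (hv : ∀ i, inner ℂ v (x i) = 0) : v = 0 := by
    have h : Submodule.span ℂ (Set.range x) ≤ (Submodule.span ℂ {v})ᗮ := by
      rw [Submodule.span_le]
      rintro _ ⟨i, rfl⟩
      exact Submodule.mem_orthogonal_singleton_iff_inner_right.mpr (hv i)
    rw [hspan] at h
    exact inner_self_eq_zero.mp
      (Submodule.mem_orthogonal_singleton_iff_inner_right.mp (h (x := v) trivial))
  have hc (k : ι) : c k ≠ 0 := fun hk =>
    b.orthonormal.ne_zero k (hzero _ fun i => by rw [hx, hk, mul_zero])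
  refine ⟨hc, fun k l hkl => ?_⟩
  by_contra hne
  have h0 := hzero (starRingEnd ℂ (c l) • b k - starRingEnd ℂ (c k) • b l) fun i => by
    simp only [inner_sub_left, inner_smul_left, hx, hkl, Complex.conj_conj]
    ring
  have h1 := congrArg (inner ℂ (b k)) h0
  rw [inner_sub_right, inner_smul_right, inner_smul_right, b.inner_eq_one,
    b.inner_eq_zero hne] at h1
  simp [hc l] at h1

/-- A finite family spanning a space of dimension `R`, with Toeplitz Gram matrix, has a Gram matrix
that is a positive combination of `R` atoms with distinct nodes on the unit circle. -/
theorem exists_vandermonde_of_gram_toeplitz {V : Type*} [NormedAddCommGroup V]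
    [InnerProductSpace ℂ V] [FiniteDimensional ℂ V] {L R : ℕ} {x : Fin L → V}
    (hToep : ∀ i j i' j' : Fin L, (j : ℤ) - (i : ℤ) = (j' : ℤ) - (i' : ℤ) →
      gram ℂ x i j = gram ℂ x i' j')
    (hspan : Submodule.span ℂ (Set.range x) = ⊤) (hR : Module.finrank ℂ V = R) :
    ∃ (p : Fin R → ℝ) (z : Fin R → ℂ), (∀ k, 0 < p k) ∧ Function.Injective z ∧ (∀ k, ‖z k‖ = 1) ∧
      ∀ i j, gram ℂ x i j =
        ∑ k, (p k : ℂ) * (z k ^ (i : ℕ) * starRingEnd ℂ (z k ^ (j : ℕ))) := by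
  obtain ⟨U, v, hU⟩ : ∃ (U : V →ₗᵢ[ℂ] V) (v : V), ∀ i, x i = (U^[i]) v := by
    rcases L with _ | n
    · exact ⟨LinearIsometry.id, 0, fun i => i.elim0⟩
    obtain ⟨U, hU⟩ := exists_linearIsometry_of_gram_eq
      (x := fun i : Fin n => x i.castSucc) (y := fun i => x i.succ) (by
        ext i j
        exact hToep i.castSucc j.castSucc i.succ j.succ (by simp))
    refine ⟨U, x 0, fun i => ?_⟩
    induction i using Fin.induction with
    | zero => rfl
    | succ i ih => rw [← hU, ih, Fin.val_succ, Function.iterate_succ_apply', Fin.val_castSucc]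
  obtain ⟨b, z, hb⟩ := U.exists_orthonormalBasis_apply_eq_smul hR
  have hx (i : Fin L) (k) : inner ℂ (b k) (x i) = z k ^ (i : ℕ) * inner ℂ (b k) v := by
    rw [hU]
    induction (i : ℕ) with
    | zero => simp
    | succ n ih =>
      rw [Function.iterate_succ_apply', U.inner_apply_of_apply_eq_smul (hb k), ih, pow_succ']
      ring
  obtain ⟨hc, hz⟩ := eigenbasis_of_cyclic b hx hspan
  refine ⟨fun k => ‖inner ℂ (b k) v‖ ^ 2, fun k => starRingEnd ℂ (z k),
    fun k => pow_pos (norm_pos_iff.mpr (hc k)) 2, (starRingEnd ℂ).injective.comp hz,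
    fun k => ?_, fun i j => ?_⟩
  · rw [RCLike.norm_conj]
    exact U.norm_eq_one_of_apply_eq_smul (hb k) (b.orthonormal.ne_zero k)
  · rw [gram_apply, ← b.sum_inner_mul_inner]
    refine Finset.sum_congr rfl fun k _ => ?_
    rw [← inner_conj_symm, hx, hx, Complex.ofReal_pow, ← Complex.mul_conj']
    simp only [map_mul, map_pow, Complex.conj_conj]
    ring

theorem stmt_8 {L R : ℕ} (T : Matrix (Fin L) (Fin L) ℂ)
    (hToep : ∀ i j i' j' : Fin L, (j : ℤ) - (i : ℤ) = (j' : ℤ) - (i' : ℤ) → T i j = T i' j')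
    (hpsd : T.PosSemidef) (hrank : T.rank = R) :
    ∃ (p f : Fin R → ℝ), (∀ k, 0 < p k) ∧ Function.Injective f ∧
      (∀ k, f k ∈ Set.Ico (0 : ℝ) 1) ∧
      T = ∑ k, (p k : ℂ) •
        Matrix.vecMulVec (wvec L (f k)) (fun j => starRingEnd ℂ (wvec L (f k) j)) := by
  obtain ⟨V, x, rfl, hspan, hV⟩ := hpsd.exists_gram_eq
  obtain ⟨p, z, hp, hz, hnorm, hgram⟩ :=
    exists_vandermonde_of_gram_toeplitz hToep hspan (hV.trans hrank)
  choose f hf hfz using fun k => Complex.exists_exp_two_pi_mul_I_eq (hnorm k)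
  refine ⟨p, f, hp, fun k l hkl => hz ?_, hf, ?_⟩
  · rw [← hfz k, ← hfz l, hkl]
  · ext i j
    rw [hgram, Matrix.sum_apply]
    simp only [Matrix.smul_apply, vecMulVec_apply, wvec_apply, hfz, smul_eq_mul]
end

section
/- Let T ∈ ℂ^{L×L} be a Hermitian positive semidefinite Toeplitz matrix of rank R < L. If T = Σ_{k=1}^R p_k w_L(f_k) w_L(f_k)ᴴ = Σ_{k=1}^R q_k w_L(g_k) w_L(g_k)ᴴ are two Vandermonde decompositions with p_k, q_k > 0 and f₁,…,f_R ∈ [0,1) pairwise distinct and g₁,…,g_R ∈ [0,1) pairwise distinct, then the multisets {(f_k, p_k)} and {(g_k, q_k)} coincide, i.e., there is a permutation π of {1,…,R} with g_k = f_{π(k)} and q_k = p_{π(k)} for all k. -/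
open Matrix ComplexOrder

open Polynomial in
/-- The quadratic form of a sum of sinusoidal atoms, at the coefficient vector of `P`. -/
theorem sum_coeff_mul_atoms {L R : ℕ} (p f : Fin R → ℝ) (P : ℂ[X]) (hP : P.natDegree < L) :
    ∑ i : Fin L, ∑ j : Fin L, P.coeff i * starRingEnd ℂ (P.coeff j) *
      (∑ k, (p k : ℂ) • Matrix.vecMulVec (wvec L (f k))
        (fun j => starRingEnd ℂ (wvec L (f k) j))) i j =
    ((∑ k, p k * Complex.normSq (P.eval (Complex.exp (2 * Real.pi * Complex.I * f k))) : ℝ) :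
      ℂ) := by
  have heval (x : ℝ) : P.eval (Complex.exp (2 * Real.pi * Complex.I * x)) =
      ∑ i : Fin L, P.coeff i * wvec L x i := by
    rw [eval_eq_sum_range' hP, ← Fin.sum_univ_eq_sum_range
      (fun i => P.coeff i * Complex.exp (2 * Real.pi * Complex.I * x) ^ i)]
    refine Finset.sum_congr rfl fun i _ => ?_
    rw [wvec, ← Complex.exp_nat_mul, mul_comm (i : ℂ)]
  push_cast
  simp_rw [← Complex.mul_conj, heval, map_sum, map_mul, Finset.sum_mul_sum, Matrix.sum_apply,
    Matrix.smul_apply, Matrix.vecMulVec_apply, smul_eq_mul, Finset.mul_sum]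
  rw [Finset.sum_comm_cycle]
  refine Finset.sum_congr rfl fun k _ => Finset.sum_congr rfl fun i _ =>
    Finset.sum_congr rfl fun j _ => ?_
  ring

/-- Distinct frequencies in `[0, 1)` give distinct points of the unit circle. -/
theorem exp_two_pi_mul_I_injOn :
    Set.InjOn (fun f : ℝ => Complex.exp (2 * Real.pi * Complex.I * f)) (Set.Ico 0 1) := by
  intro a ha b hb h
  obtain ⟨n, hn⟩ := Complex.exp_eq_exp_iff_exists_int.mp h
  have hab : a = b + n := by
    have : (2 * Real.pi * Complex.I) * (a : ℂ) = (2 * Real.pi * Complex.I) * (b + n) := by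
      rw [hn]; ring
    exact_mod_cast mul_left_cancel₀ Complex.two_pi_I_ne_zero this
  have h1 : (n : ℝ) < 1 := by linarith [ha.2, hb.1]
  have h2 : (-1 : ℝ) < n := by linarith [ha.1, hb.2]
  have h0 : n = 0 := by
    have h1' : n < 1 := by exact_mod_cast h1
    have h2' : -1 < n := by exact_mod_cast h2
    omega
  simpa [h0] using hab

theorem stmt_9 {L R : ℕ} (hRL : R < L) (T : Matrix (Fin L) (Fin L) ℂ)
    (hToep : ∀ i j i' j' : Fin L, (j : ℤ) - (i : ℤ) = (j' : ℤ) - (i' : ℤ) → T i j = T i' j')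
    (hpsd : T.PosSemidef) (hrank : T.rank = R)
    (p q f g : Fin R → ℝ) (hp : ∀ k, 0 < p k) (hq : ∀ k, 0 < q k)
    (hfinj : Function.Injective f) (hginj : Function.Injective g)
    (hf : ∀ k, f k ∈ Set.Ico (0 : ℝ) 1) (hg : ∀ k, g k ∈ Set.Ico (0 : ℝ) 1)
    (hdecf : T = ∑ k, (p k : ℂ) •
      Matrix.vecMulVec (wvec L (f k)) (fun j => starRingEnd ℂ (wvec L (f k) j)))
    (hdecg : T = ∑ k, (q k : ℂ) •
      Matrix.vecMulVec (wvec L (g k)) (fun j => starRingEnd ℂ (wvec L (g k) j))) :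
    ∃ π : Equiv.Perm (Fin R), ∀ k, g k = f (π k) ∧ q k = p (π k) := by
  classical
  let e (x : ℝ) : ℂ := Complex.exp (2 * Real.pi * Complex.I * x)
  have key (P : Polynomial ℂ) (hP : P.natDegree < L) :
      ∑ k, p k * Complex.normSq (P.eval (e (f k))) =
        ∑ k, q k * Complex.normSq (P.eval (e (g k))) := by
    have h := sum_coeff_mul_atoms p f P hP
    rw [← hdecf, hdecg, sum_coeff_mul_atoms q g P hP] at h
    exact Complex.ofReal_injective h.symm
  let N (s : Finset (Fin R)) : Polynomial ℂ :=
    ∏ j ∈ s, (Polynomial.X - Polynomial.C (e (f j)))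
  have hNdeg (s : Finset (Fin R)) : (N s).natDegree < L := by
    rw [Polynomial.natDegree_finsetProd_X_sub_C_eq_card]
    exact (card_finset_fin_le s).trans_lt hRL
  have hNeval (s : Finset (Fin R)) (x : ℝ) (hx : x ∈ Set.Ico (0 : ℝ) 1) :
      (N s).eval (e x) = 0 ↔ ∃ j ∈ s, x = f j := by
    simp only [N, Polynomial.eval_prod, Finset.prod_eq_zero_iff, Polynomial.eval_sub,
      Polynomial.eval_X, Polynomial.eval_C, sub_eq_zero]
    exact exists_congr fun j => and_congr_right fun _ =>
      exp_two_pi_mul_I_injOn.eq_iff hx (hf j)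
  have hexists (k : Fin R) : ∃ j, g k = f j := by
    have h := key (N Finset.univ) (hNdeg _)
    have hzero : ∑ k, p k * Complex.normSq ((N Finset.univ).eval (e (f k))) = 0 :=
      Finset.sum_eq_zero fun j _ => by
        rw [(hNeval _ _ (hf j)).mpr ⟨j, Finset.mem_univ j, rfl⟩, map_zero, mul_zero]
    rw [hzero, eq_comm, Finset.sum_eq_zero_iff_of_nonneg
      fun j _ => mul_nonneg (hq j).le (Complex.normSq_nonneg _)] at h
    have hk := (mul_eq_zero_iff_left (hq k).ne').mp (h k (Finset.mem_univ k))
    obtain ⟨j, -, hj⟩ := (hNeval _ _ (hg k)).mp (Complex.normSq_eq_zero.mp hk)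
    exact ⟨j, hj⟩
  choose π hπ using hexists
  have hπinj : Function.Injective π := fun a b hab => hginj (by rw [hπ, hπ, hab])
  refine ⟨Equiv.ofBijective π (Finite.injective_iff_bijective.mp hπinj), fun k => ⟨hπ k, ?_⟩⟩
  have h := key (N (Finset.univ.erase (π k))) (hNdeg _)
  have hvanish (j : Fin R) (hj : j ≠ π k) :
      (N (Finset.univ.erase (π k))).eval (e (f j)) = 0 :=
    (hNeval _ _ (hf j)).mpr ⟨j, Finset.mem_erase.mpr ⟨hj, Finset.mem_univ j⟩, rfl⟩
  rw [Fintype.sum_eq_single (π k) fun j hj => by rw [hvanish j hj, map_zero, mul_zero],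
    Fintype.sum_eq_single k fun j hj => by
      rw [hπ, hvanish _ (hπinj.ne hj), map_zero, mul_zero], hπ k] at h
  refine (mul_right_cancel₀ (fun h0 => ?_) h).symm
  obtain ⟨j, hj, hjk⟩ := (hNeval _ _ (hf (π k))).mp (Complex.normSq_eq_zero.mp h0)
  exact Finset.ne_of_mem_erase hj (hfinj hjk).symm
end

section
/- For every x ∈ ℝ, exp(−2x²) ≤ 4 Φ(x)(1 − Φ(x)); equivalently, the weight function ω(x) = exp(−2x²)/(2π Φ(x)(1 − Φ(x))) satisfies ω(x) ≤ 2/π, with equality at x = 0. -/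
/-- The Gaussian CDF `Φ(x) = (1/√π) ∫_{−∞}^{x} e^{−t²} dt`. -/
noncomputable def Phi (x : ℝ) : ℝ :=
  (Real.sqrt Real.pi)⁻¹ * ∫ t in Set.Iic x, Real.exp (-t ^ 2)

/-- The weight function `ω(x) = exp(−2x²)/(2π Φ(x)(1 − Φ(x)))`. -/
noncomputable def omegaW (x : ℝ) : ℝ :=
  Real.exp (-2 * x ^ 2) / (2 * Real.pi * Phi x * (1 - Phi x))

open MeasureTheory Set

/-- Differentiating `∫₀¹ e^{-y²(1+t²)} / (1+t²) dt` in `y` gives `-2 e^{-y²} ∫₀ʸ e^{-t²} dt`. -/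
theorem hasDerivAt_integral_exp_div_one_add_sq (x : ℝ) :
    HasDerivAt (fun y : ℝ => ∫ t in (0 : ℝ)..1, Real.exp (-y ^ 2 * (1 + t ^ 2)) / (1 + t ^ 2))
      (-2 * Real.exp (-x ^ 2) * ∫ t in (0 : ℝ)..x, Real.exp (-t ^ 2)) x := by
  have hpos (t : ℝ) : 1 + t ^ 2 ≠ 0 := by positivity
  have hcont (y : ℝ) :
      Continuous fun t : ℝ => Real.exp (-y ^ 2 * (1 + t ^ 2)) / (1 + t ^ 2) :=
    Continuous.div (by fun_prop) (by fun_prop) hpos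
  have hderiv := (intervalIntegral.hasDerivAt_integral_of_dominated_loc_of_deriv_le
    (μ := volume) (a := 0) (b := 1) (x₀ := x) (s := Metric.ball x 1)
    (F := fun y t : ℝ => Real.exp (-y ^ 2 * (1 + t ^ 2)) / (1 + t ^ 2))
    (F' := fun y t : ℝ => -2 * y * Real.exp (-y ^ 2 * (1 + t ^ 2)))
    (bound := fun _ => 2 * (|x| + 1)) (Metric.ball_mem_nhds x one_pos)
    (.of_forall fun y => (hcont y).aestronglyMeasurable)
    ((hcont x).intervalIntegrable _ _)
    (Continuous.aestronglyMeasurable (by fun_prop))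
    (.of_forall fun t _ y hy => ?_) intervalIntegrable_const
    (.of_forall fun t _ y _ => ?_)).2
  · refine hderiv.congr_deriv ?_
    have hscale := intervalIntegral.mul_integral_comp_mul_left
      (f := fun t : ℝ => Real.exp (-t ^ 2)) (c := x) (a := 0) (b := 1)
    rw [mul_zero, mul_one] at hscale
    rw [← hscale, ← mul_assoc, ← intervalIntegral.integral_const_mul]
    refine intervalIntegral.integral_congr fun t _ => ?_
    have hexp : Real.exp (-x ^ 2 * (1 + t ^ 2))
        = Real.exp (-x ^ 2) * Real.exp (-(x * t) ^ 2) := by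
      rw [← Real.exp_add]; ring_nf
    simp only [hexp]
    ring
  · have hy' : |y| ≤ |x| + 1 := by
      have := abs_sub_abs_le_abs_sub y x
      rw [Metric.mem_ball, Real.dist_eq] at hy
      linarith
    have hexp : Real.exp (-y ^ 2 * (1 + t ^ 2)) ≤ 1 :=
      Real.exp_le_one_iff.2 (by nlinarith [mul_nonneg (sq_nonneg y) (sq_nonneg t), sq_nonneg y])
    rw [norm_mul, norm_mul, Real.norm_eq_abs, Real.norm_eq_abs, Real.norm_eq_abs, Real.abs_exp,
      abs_neg, abs_two]
    exact mul_le_of_le_one_right (by positivity) hexp |>.trans (by linarith)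
  · have h := (((hasDerivAt_pow 2 y).neg.mul_const (1 + t ^ 2)).exp).div_const (1 + t ^ 2)
    refine h.congr_deriv ?_
    rw [div_eq_iff (hpos t), Pi.neg_apply]
    push_cast
    ring

theorem sq_integral_exp_neg_sq_add (x : ℝ) :
    (∫ t in (0 : ℝ)..x, Real.exp (-t ^ 2)) ^ 2
      + ∫ t in (0 : ℝ)..1, Real.exp (-x ^ 2 * (1 + t ^ 2)) / (1 + t ^ 2) = Real.pi / 4 := by
  have hderiv (y : ℝ) : HasDerivAt (fun y : ℝ => (∫ t in (0 : ℝ)..y, Real.exp (-t ^ 2)) ^ 2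
      + ∫ t in (0 : ℝ)..1, Real.exp (-y ^ 2 * (1 + t ^ 2)) / (1 + t ^ 2)) 0 y := by
    have hcont : Continuous fun t : ℝ => Real.exp (-t ^ 2) := by fun_prop
    have h := ((hcont.integral_hasStrictDerivAt 0 y).hasDerivAt.pow 2).add
      (hasDerivAt_integral_exp_div_one_add_sq y)
    refine h.congr_deriv ?_
    push_cast
    ring
  have hconst := is_const_of_deriv_eq_zero (fun y => (hderiv y).differentiableAt)
    (fun y => (hderiv y).deriv) x 0
  refine hconst.trans ?_
  simp

/-- The Gaussian mass of a square is at most that of its circumscribed disc. -/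
theorem sq_integral_exp_neg_sq_le (x : ℝ) :
    (∫ t in (0 : ℝ)..x, Real.exp (-t ^ 2)) ^ 2
      ≤ Real.pi / 4 * (1 - Real.exp (-2 * x ^ 2)) := by
  have hpos (t : ℝ) : 1 + t ^ 2 ≠ 0 := by positivity
  have hle : ∫ t in (0 : ℝ)..1, Real.exp (-2 * x ^ 2) * (1 / (1 + t ^ 2))
      ≤ ∫ t in (0 : ℝ)..1, Real.exp (-x ^ 2 * (1 + t ^ 2)) / (1 + t ^ 2) := by
    refine intervalIntegral.integral_mono_on zero_le_one
      (Continuous.intervalIntegrable ?_ _ _) (Continuous.intervalIntegrable ?_ _ _)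
      fun t ht => ?_
    · exact continuous_const.mul (Continuous.div (by fun_prop) (by fun_prop) hpos)
    · exact Continuous.div (by fun_prop) (by fun_prop) hpos
    · rw [mul_one_div]
      have : t ^ 2 ≤ 1 := pow_le_one₀ ht.1 ht.2
      gcongr ?_ / _
      refine Real.exp_le_exp.2 ?_
      nlinarith [mul_nonneg (sq_nonneg x) (sub_nonneg.2 this)]
  rw [intervalIntegral.integral_const_mul, integral_one_div_one_add_sq] at hle
  simp only [Real.arctan_one, Real.arctan_zero, sub_zero] at hle
  linarith [sq_integral_exp_neg_sq_add x]

theorem Phi_eq (x : ℝ) :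
    Phi x = 1 / 2 + (Real.sqrt Real.pi)⁻¹ * ∫ t in (0 : ℝ)..x, Real.exp (-t ^ 2) := by
  have hint : Integrable fun t : ℝ => Real.exp (-t ^ 2) := by
    simpa using integrable_exp_neg_mul_sq one_pos
  have hhalf : ∫ t in Iic (0 : ℝ), Real.exp (-t ^ 2) = Real.sqrt Real.pi / 2 := by
    have h := integral_comp_neg_Iic (0 : ℝ) fun t : ℝ => Real.exp (-t ^ 2)
    have hg := integral_gaussian_Ioi 1
    simp only [neg_sq, neg_zero] at h
    simp only [neg_mul, one_mul, div_one] at hg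
    rw [h, hg]
  have hsub := intervalIntegral.integral_Iic_sub_Iic (a := 0) (b := x)
    hint.integrableOn hint.integrableOn
  have hsqrt : Real.sqrt Real.pi ≠ 0 := (Real.sqrt_pos.2 Real.pi_pos).ne'
  rw [Phi, ← hsub, hhalf]
  field_simp
  ring

theorem four_mul_Phi_mul_one_sub_Phi (x : ℝ) :
    4 * Phi x * (1 - Phi x)
      = 1 - 4 / Real.pi * (∫ t in (0 : ℝ)..x, Real.exp (-t ^ 2)) ^ 2 := by
  have hsq : (Real.sqrt Real.pi)⁻¹ ^ 2 = Real.pi⁻¹ := by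
    rw [inv_pow, Real.sq_sqrt Real.pi_pos.le]
  rw [Phi_eq, div_eq_mul_inv 4, ← hsq]
  ring

theorem exp_neg_two_mul_sq_le (x : ℝ) :
    Real.exp (-2 * x ^ 2) ≤ 4 * Phi x * (1 - Phi x) := by
  have h := mul_le_mul_of_nonneg_left (sq_integral_exp_neg_sq_le x)
    (by positivity : 0 ≤ 4 / Real.pi)
  have hcancel : 4 / Real.pi * (Real.pi / 4 * (1 - Real.exp (-2 * x ^ 2)))
      = 1 - Real.exp (-2 * x ^ 2) := by
    field_simp
  rw [four_mul_Phi_mul_one_sub_Phi]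
  linarith

theorem stmt_10 (x : ℝ) :
    Real.exp (-2 * x ^ 2) ≤ 4 * Phi x * (1 - Phi x) ∧
    omegaW x ≤ 2 / Real.pi ∧ omegaW 0 = 2 / Real.pi := by
  refine ⟨exp_neg_two_mul_sq_le x, ?_, ?_⟩
  · have hle := exp_neg_two_mul_sq_le x
    have hpos : 0 < Phi x * (1 - Phi x) := by
      linarith [Real.exp_pos (-2 * x ^ 2)]
    rw [omegaW, mul_assoc, div_le_div_iff₀ (by positivity) Real.pi_pos]
    nlinarith [mul_le_mul_of_nonneg_right hle Real.pi_pos.le]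
  · have hzero : Phi 0 = 1 / 2 := by simp [Phi_eq]
    rw [omegaW, hzero]
    norm_num
    field_simp
end
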